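/- For every real number κ with 0 < κ ≤ 1, the function f_κ is operator monotone: for every n ≥ 1 and all positive definite Hermitian n×n complex matrices A, B with A ≤ B in the Loewner order (i.e. B − A is positive semidefinite), one has f_κ(A) ≤ f_κ(B), where f_κ is applied to a positive definite matrix via the functional calculus (applying f_κ to the eigenvalues in a unitary diagonalization). -/

import Mathlib

open Matrix
open scoped ComplexOrder

/-- The function `f_κ(x) = (κ/2)·(x−1)(x^κ+1)/(x^κ−1)` for `x ≠ 1`, with `f_κ(1) = 1`.
Here `x ^ κ` is the real power of the positive real `x`. -/
noncomputable def fKappa (κ : ℝ) : ℝ → ℝ := fun x =>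
  if x = 1 then 1 else κ / 2 * ((x - 1) * (x ^ κ + 1)) / (x ^ κ - 1)

open scoped MatrixOrder Matrix.Norms.L2Operator in
lemma aux_inv_anti {n : ℕ} {A B : Matrix (Fin n) (Fin n) ℂ} (hA : A.PosDef) (hB : B.PosDef)
    (h : (B - A).PosSemidef) : (A⁻¹ - B⁻¹).PosSemidef := by
  have h1 : A ≤ B := Matrix.le_iff.mpr h
  have := CStarAlgebra.antitoneOn_ringInverse (A := Matrix (Fin n) (Fin n) ℂ)
    hA.isStrictlyPositive hB.isStrictlyPositive h1
  rw [← Matrix.nonsing_inv_eq_ringInverse, ← Matrix.nonsing_inv_eq_ringInverse] at this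
  exact Matrix.le_iff.mp this

lemma aux_quad {n : ℕ} {A : Matrix (Fin n) (Fin n) ℂ} (hA : A.IsHermitian) (v : Fin n → ℂ) :
    ∃ w : Fin n → ℝ, (∀ i, 0 ≤ w i) ∧ ∀ g : ℝ → ℝ, star v ⬝ᵥ (hA.cfc g *ᵥ v) =
      ((∑ i, g (hA.eigenvalues i) * w i : ℝ) : ℂ) := by
  refine ⟨fun i => Complex.normSq (((star (hA.eigenvectorUnitary : Matrix (Fin n) (Fin n) ℂ)) *ᵥ v) i),
    fun i => Complex.normSq_nonneg _, fun g => ?_⟩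
  rw [Matrix.IsHermitian.cfc, Unitary.conjStarAlgAut_apply, ← Matrix.mulVec_mulVec,
    ← Matrix.mulVec_mulVec, Matrix.dotProduct_mulVec]
  set U := (hA.eigenvectorUnitary : Matrix (Fin n) (Fin n) ℂ)
  have : star v ᵥ* U = star (star U *ᵥ v) := by
    rw [Matrix.star_mulVec, Matrix.star_eq_conjTranspose, Matrix.conjTranspose_conjTranspose]
  rw [this]
  simp only [dotProduct, Matrix.mulVec_diagonal, Complex.ofReal_sum]
  refine Finset.sum_congr rfl fun i _ => ?_
  rw [Complex.ofReal_mul, Complex.normSq_eq_conj_mul_self]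
  simp only [Pi.star_apply, Function.comp_apply, RCLike.star_def, Complex.coe_algebraMap]
  change _ * ((g (hA.eigenvalues i) : ℂ) * _) = _
  ring

lemma aux_cont {n : ℕ} (A : Matrix (Fin n) (Fin n) ℂ) (g : ℝ → ℝ) :
    ContinuousOn g (spectrum ℝ A) := by
  rw [continuousOn_iff_continuous_domRestrict]; fun_prop

lemma aux_herm {n : ℕ} {A : Matrix (Fin n) (Fin n) ℂ} (hA : A.IsHermitian) (g : ℝ → ℝ) :
    (hA.cfc g).IsHermitian := by
  rw [← hA.cfc_eq]
  exact cfc_predicate g A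

lemma aux_congr {n : ℕ} {A : Matrix (Fin n) (Fin n) ℂ} (hA : A.PosDef) {g h : ℝ → ℝ}
    (H : ∀ x, 0 < x → g x = h x) : hA.isHermitian.cfc g = hA.isHermitian.cfc h := by
  have : g ∘ hA.isHermitian.eigenvalues = h ∘ hA.isHermitian.eigenvalues := by
    ext i; exact H _ (hA.eigenvalues_pos i)
  rw [Matrix.IsHermitian.cfc, Matrix.IsHermitian.cfc, this]

lemma aux_inv {n : ℕ} {A : Matrix (Fin n) (Fin n) ℂ} (hA : A.PosDef) {g : ℝ → ℝ}
    (H : ∀ x, 0 < x → 0 < g x) :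
    hA.isHermitian.cfc (fun x => (g x)⁻¹) = (hA.isHermitian.cfc g)⁻¹ := by
  symm
  apply Matrix.inv_eq_left_inv
  have h1 : hA.isHermitian.cfc (fun x => (g x)⁻¹ * g x) = hA.isHermitian.cfc (fun x => 1) :=
    aux_congr hA fun x hx => inv_mul_cancel₀ (H x hx).ne'
  rw [← hA.isHermitian.cfc_eq, ← hA.isHermitian.cfc_eq] at h1 ⊢
  rw [← cfc_mul _ _ A (aux_cont _ _) (aux_cont _ _), h1]
  exact cfc_const_one ℝ A hA.isHermitian

lemma aux_posdef {n : ℕ} {A : Matrix (Fin n) (Fin n) ℂ} (hA : A.PosDef) {g : ℝ → ℝ}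
    (H : ∀ x, 0 < x → 0 < g x) : (hA.isHermitian.cfc g).PosDef := by
  have hps : (hA.isHermitian.cfc g).PosSemidef := by
    refine Matrix.PosSemidef.of_dotProduct_mulVec_nonneg (aux_herm _ _) fun v => ?_
    obtain ⟨w, hw, hq⟩ := aux_quad hA.isHermitian v
    rw [hq, Complex.zero_le_real]
    exact Finset.sum_nonneg fun i _ => mul_nonneg (H _ (hA.eigenvalues_pos i)).le (hw i)
  rw [hps.posDef_iff_isUnit]
  have h1 : hA.isHermitian.cfc (fun x => (g x)⁻¹ * g x) = hA.isHermitian.cfc (fun x => 1) :=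
    aux_congr hA fun x hx => inv_mul_cancel₀ (H x hx).ne'
  have h2 : hA.isHermitian.cfc (fun x => (g x)⁻¹) * hA.isHermitian.cfc g = 1 := by
    rw [← hA.isHermitian.cfc_eq, ← hA.isHermitian.cfc_eq] at h1 ⊢
    rw [← cfc_mul _ _ A (aux_cont _ _) (aux_cont _ _), h1]
    exact cfc_const_one ℝ A hA.isHermitian
  exact IsUnit.of_mul_eq_one_right _ h2

lemma aux_affine {n : ℕ} {A : Matrix (Fin n) (Fin n) ℂ} (hA : A.IsHermitian) (a b c : ℝ)
    (g : ℝ → ℝ) : hA.cfc (fun x => (a + b * x) + c * g x) =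
      (a • (1 : Matrix (Fin n) (Fin n) ℂ) + b • A) + c • hA.cfc g := by
  rw [← hA.cfc_eq, ← hA.cfc_eq]
  have hA' : IsSelfAdjoint A := hA
  rw [cfc_add (a := A) _ _ (aux_cont _ _) (aux_cont _ _),
    cfc_add (a := A) _ _ (aux_cont _ _) (aux_cont _ _), cfc_const_mul _ _ A (aux_cont _ _),
    cfc_const_mul _ _ A (aux_cont _ _), cfc_id' ℝ A, cfc_const a A, Algebra.algebraMap_eq_smul_one]

/-- resolvents are antitone -/
lemma aux_res {n : ℕ} {A B : Matrix (Fin n) (Fin n) ℂ} (hA : A.PosDef) (hB : B.PosDef)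
    (h : (B - A).PosSemidef) {t : ℝ} (ht : 0 < t) :
    (hA.isHermitian.cfc (fun x => (t + x)⁻¹) - hB.isHermitian.cfc (fun x => (t + x)⁻¹)).PosSemidef := by
  have H : ∀ x : ℝ, 0 < x → 0 < t + x := fun x hx => by positivity
  rw [aux_inv hA H, aux_inv hB H]
  refine aux_inv_anti (aux_posdef hA H) (aux_posdef hB H) ?_
  have e := aux_affine hA.isHermitian t 1 0 (fun _ => 0)
  have e' := aux_affine hB.isHermitian t 1 0 (fun _ => 0)
  simp only [one_mul, zero_mul, add_zero, one_smul, zero_smul] at e e'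
  rw [e, e']
  simpa using h

noncomputable def auxC (p : ℝ) : ℝ := ∫ t in Set.Ioi (0:ℝ), Real.rpowIntegrand₀₁ p t 1

noncomputable def auxK (p t : ℝ) : ℝ := (auxC p)⁻¹ * (t ^ p * (t + 1)⁻¹)

noncomputable def auxH (p x : ℝ) : ℝ := ∫ t in Set.Ioi (0:ℝ), auxK p t * (t + x)⁻¹

lemma auxC_pos {p : ℝ} (hp : p ∈ Set.Ioo 0 1) : 0 < auxC p :=
  Real.integral_rpowIntegrand₀₁_one_pos hp

lemma auxK_pos {p t : ℝ} (hp : p ∈ Set.Ioo 0 1) (ht : 0 < t) : 0 < auxK p t := by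
  have := auxC_pos hp
  unfold auxK; positivity

open MeasureTheory in
lemma aux_int {p x : ℝ} (hp : p ∈ Set.Ioo 0 1) (hx : 0 < x) :
    IntegrableOn (fun t => auxK p t * (t + x)⁻¹) (Set.Ioi 0) := by
  have h1 : IntegrableOn (fun t => (auxC p)⁻¹ * (x⁻¹ + 1) * Real.rpowIntegrand₀₁ p t 1) (Set.Ioi 0) :=
    (Real.integrableOn_rpowIntegrand₀₁_Ioi hp zero_le_one).const_mul _
  refine Integrable.mono' h1 ?_ ?_
  · apply Measurable.aestronglyMeasurable
    unfold auxK; fun_prop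
  · refine ae_restrict_of_forall_mem measurableSet_Ioi fun t ht => ?_
    have ht : 0 < t := ht
    have hk := auxK_pos hp ht
    have hC := auxC_pos hp
    rw [Real.norm_of_nonneg (by positivity)]
    unfold auxK Real.rpowIntegrand₀₁
    have e : t⁻¹ - (t+1)⁻¹ = t⁻¹ * (t+1)⁻¹ := by field_simp; ring
    rw [e]
    have : (t + x)⁻¹ ≤ (x⁻¹ + 1) * t⁻¹ := by
      have : (t+x)⁻¹ ≤ t⁻¹ := by gcongr; linarith
      have h2 : 0 < x⁻¹ * t⁻¹ := by positivity
      linarith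
    calc _ ≤ (auxC p)⁻¹ * (t ^ p * (t + 1)⁻¹) * ((x⁻¹ + 1) * t⁻¹) := by gcongr
      _ = _ := by ring

open MeasureTheory in
lemma auxH_pos {p x : ℝ} (hp : p ∈ Set.Ioo 0 1) (hx : 0 < x) : 0 < auxH p x := by
  unfold auxH
  rw [setIntegral_pos_iff_support_of_nonneg_ae _ (aux_int hp hx)]
  · have : Set.Ioi (0:ℝ) ⊆ Function.support (fun t => auxK p t * (t + x)⁻¹) := by
      intro t ht
      have ht : 0 < t := ht
      have hk := auxK_pos hp ht
      have : 0 < auxK p t * (t + x)⁻¹ := by positivity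
      exact this.ne'
    rw [Set.inter_eq_self_of_subset_right this]
    simp
  · refine ae_restrict_of_forall_mem measurableSet_Ioi fun t ht => ?_
    have ht : 0 < t := ht
    have hk := auxK_pos hp ht
    simp only [Pi.zero_apply]
    positivity

open MeasureTheory in
lemma auxH_eq {p x : ℝ} (hp : p ∈ Set.Ioo 0 1) (hx : 0 < x) :
    x ^ p - 1 = (x - 1) * auxH p x := by
  have h1 := Real.rpow_eq_const_mul_integral hp hx.le
  have h2 : (auxC p)⁻¹ * ∫ t in Set.Ioi 0, Real.rpowIntegrand₀₁ p t 1 = 1 :=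
    inv_mul_cancel₀ (auxC_pos hp).ne'
  change x ^ p = (auxC p)⁻¹ * _ at h1
  have h3 : x ^ p - 1 = (auxC p)⁻¹ * (∫ t in Set.Ioi 0, Real.rpowIntegrand₀₁ p t x) -
      (auxC p)⁻¹ * ∫ t in Set.Ioi 0, Real.rpowIntegrand₀₁ p t 1 := by rw [h1, h2]
  rw [h3, ← mul_sub, ← integral_sub (Real.integrableOn_rpowIntegrand₀₁_Ioi hp hx.le)
    (Real.integrableOn_rpowIntegrand₀₁_Ioi hp zero_le_one), auxH, ← integral_const_mul,
    ← integral_const_mul]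
  refine setIntegral_congr_fun measurableSet_Ioi fun t ht => ?_
  have ht : 0 < t := ht
  have hC := auxC_pos hp
  simp only [Real.rpowIntegrand₀₁, auxK]
  field_simp
  ring

open MeasureTheory in
lemma auxH_anti {p x y : ℝ} (hp : p ∈ Set.Ioo 0 1) (hx : 0 < x) (hxy : x ≤ y) :
    auxH p y ≤ auxH p x := by
  refine setIntegral_mono_on (aux_int hp (hx.trans_le hxy)) (aux_int hp hx) measurableSet_Ioi
    fun t ht => ?_
  have ht : 0 < t := ht
  have hk := auxK_pos hp ht
  gcongr

lemma auxH_one {p : ℝ} (hp : p ∈ Set.Ioo 0 1) : auxH p 1 = p := by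
  have hd : HasDerivAt (fun x : ℝ => x ^ p) p 1 := by
    simpa using Real.hasDerivAt_rpow_const (x := 1) (p := p) (Or.inl one_ne_zero)
  have hs := hasDerivAt_iff_tendsto_slope.mp hd
  have e : ∀ x : ℝ, 0 < x → x ≠ 1 → slope (fun x : ℝ => x ^ p) 1 x = auxH p x := by
    intro x hx h1
    have : x - 1 ≠ 0 := sub_ne_zero.mpr h1
    rw [slope_def_field, Real.one_rpow, auxH_eq hp hx]
    field_simp
  apply le_antisymm
  · have hl := hs.mono_left (nhdsWithin_mono 1 (s := Set.Iio 1) fun x hx => ne_of_lt hx)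
    refine ge_of_tendsto hl ?_
    filter_upwards [Ioo_mem_nhdsLT (show (0:ℝ) < 1 by norm_num)] with x hx
    rw [e x hx.1 hx.2.ne]
    exact auxH_anti hp hx.1 hx.2.le
  · have hl := hs.mono_left (nhdsWithin_mono 1 (s := Set.Ioi 1) fun x hx => ne_of_gt hx)
    refine le_of_tendsto hl ?_
    filter_upwards [self_mem_nhdsWithin] with x hx
    have hx : 1 < x := hx
    rw [e x (by linarith) hx.ne']
    exact auxH_anti hp one_pos hx.le

open MeasureTheory in
lemma auxH_op {p : ℝ} (hp : p ∈ Set.Ioo 0 1) {n : ℕ} {A B : Matrix (Fin n) (Fin n) ℂ}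
    (hA : A.PosDef) (hB : B.PosDef) (h : (B - A).PosSemidef) :
    (hA.isHermitian.cfc (auxH p) - hB.isHermitian.cfc (auxH p)).PosSemidef := by
  refine Matrix.PosSemidef.of_dotProduct_mulVec_nonneg
    ((aux_herm _ _).sub (aux_herm _ _)) fun v => ?_
  obtain ⟨w, hw, hq⟩ := aux_quad hA.isHermitian v
  obtain ⟨w', hw', hq'⟩ := aux_quad hB.isHermitian v
  rw [Matrix.sub_mulVec, dotProduct_sub, hq, hq', sub_nonneg, Complex.real_le_real]
  have key : ∀ {M : Matrix (Fin n) (Fin n) ℂ} (hM : M.PosDef) (w : Fin n → ℝ),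
      IntegrableOn (fun t => ∑ i, auxK p t * (t + hM.isHermitian.eigenvalues i)⁻¹ * w i) (Set.Ioi 0) ∧
      ∑ i, auxH p (hM.isHermitian.eigenvalues i) * w i =
      ∫ t in Set.Ioi 0, ∑ i, auxK p t * (t + hM.isHermitian.eigenvalues i)⁻¹ * w i := by
    intro M hM w
    have hi : ∀ i ∈ Finset.univ, IntegrableOn
        (fun t => auxK p t * (t + hM.isHermitian.eigenvalues i)⁻¹ * w i) (Set.Ioi 0) :=
      fun i _ => (aux_int hp (hM.eigenvalues_pos i)).mul_const _
    refine ⟨integrable_finsetSum _ hi, ?_⟩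
    rw [integral_finsetSum _ hi]
    refine Finset.sum_congr rfl fun i _ => ?_
    rw [integral_mul_const, auxH]
  rw [(key hA w).2, (key hB w').2]
  refine setIntegral_mono_on (key hB w').1 (key hA w).1 measurableSet_Ioi fun t ht => ?_
  have ht : 0 < t := ht
  have hk := auxK_pos hp ht
  have := (aux_res hA hB h ht).dotProduct_mulVec_nonneg v
  rw [Matrix.sub_mulVec, dotProduct_sub, hq, hq', sub_nonneg, Complex.real_le_real] at this
  simp only [mul_assoc, ← Finset.mul_sum]
  gcongr

lemma aux_final {n : ℕ} {A B : Matrix (Fin n) (Fin n) ℂ} {P Q : Matrix (Fin n) (Fin n) ℂ}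
    {a b c : ℝ} (hb : 0 ≤ b) (hc : 0 ≤ c)
    (h : (B - A).PosSemidef) (h' : (Q - P).PosSemidef) :
    (((a • (1 : Matrix (Fin n) (Fin n) ℂ) + b • B) + c • Q) -
      ((a • (1 : Matrix (Fin n) (Fin n) ℂ) + b • A) + c • P)).PosSemidef := by
  have e : ((a • (1 : Matrix (Fin n) (Fin n) ℂ) + b • B) + c • Q) -
      ((a • (1 : Matrix (Fin n) (Fin n) ℂ) + b • A) + c • P) = b • (B - A) + c • (Q - P) := by
    rw [smul_sub, smul_sub]; abel
  rw [e]
  exact (h.smul hb).add (h'.smul hc)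

/-- For `0 < κ ≤ 1`, the function `f_κ` is operator monotone: for every `n ≥ 1` and all
positive definite Hermitian `n×n` complex matrices `A ≤ B` (Loewner order), applying `f_κ`
to the eigenvalues in a unitary diagonalization yields `f_κ(A) ≤ f_κ(B)`. -/
theorem fKappa_operatorMonotone (κ : ℝ) (hκ0 : 0 < κ) (hκ1 : κ ≤ 1) :
    ∀ (n : ℕ), 1 ≤ n → ∀ (A B : Matrix (Fin n) (Fin n) ℂ)
      (hA : A.PosDef) (hB : B.PosDef), (B - A).PosSemidef →
      (hB.isHermitian.cfc (fKappa κ) - hA.isHermitian.cfc (fKappa κ)).PosSemidef := by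
  intro n _ A B hA hB h
  rcases hκ1.lt_or_eq with hlt | rfl
  · have hp : κ ∈ Set.Ioo 0 1 := ⟨hκ0, hlt⟩
    have e : ∀ x : ℝ, 0 < x →
        fKappa κ x = (-(κ/2) + (κ/2) * x) + κ * (auxH κ x)⁻¹ := by
      intro x hx
      unfold fKappa
      split_ifs with h1
      · subst h1
        rw [auxH_one hp, mul_inv_cancel₀ hκ0.ne']; ring
      · have h2 := auxH_eq hp hx
        have h3 := (auxH_pos hp hx).ne'
        have h4 : x - 1 ≠ 0 := sub_ne_zero.mpr h1
        have h5 : x ^ κ = 1 + (x - 1) * auxH κ x := by linarith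
        rw [h2, h5]
        field_simp
        ring
    have H : ∀ x : ℝ, 0 < x → 0 < auxH κ x := fun x hx => auxH_pos hp hx
    rw [aux_congr hA e, aux_congr hB e, aux_affine, aux_affine]
    refine aux_final (by positivity) hκ0.le h ?_
    rw [aux_inv hA H, aux_inv hB H]
    exact aux_inv_anti (aux_posdef hB H) (aux_posdef hA H) (auxH_op hp hA hB h)
  · have e : ∀ x : ℝ, 0 < x → fKappa 1 x = (1/2 + 1/2 * x) + 0 * (0:ℝ) := by
      intro x hx
      unfold fKappa
      split_ifs with h1
      · subst h1; norm_num
      · have h4 : x - 1 ≠ 0 := sub_ne_zero.mpr h1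
        rw [Real.rpow_one]
        field_simp
        ring
    rw [aux_congr hA e, aux_congr hB e, aux_affine _ _ _ _ (fun _ => 0),
      aux_affine _ _ _ _ (fun _ => 0)]
    rw [zero_smul, zero_smul, add_zero, add_zero, add_sub_add_left_eq_sub, ← smul_sub]
    exact h.smul (by positivity)
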